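/- arXiv:1801.09485 — 2 statements merged into one kernel-verified Lean document; each statement's English description precedes it below -/
import Mathlib

section
/- Let λ_p ∈ [0,1], ε_{s1}, ε_{s2} ∈ [0,1] with ε_{s1} ≤ ε_{s2}, β = λ_p(ε_{s2} − 1), T = λ_p(1 − ε_{s1}) + ε_{s1}, and for q ∈ [0,1]^M set θ_i(q) = β q_i + T and φ(q) = ∑_{k=1}^{M} (λ_p q_k + 1 − λ_p) ∏_{i=1}^{k-1} θ_i(q). If q satisfies q_k ≥ q_{k+1} for some index k < M, then swapping q_k and q_{k+1} leaves the cumulative outage probability ∏_{i=1}^{M} θ_i unchanged and does not increase φ; i.e., φ(q') ≤ φ(q) where q' is q with entries k and k+1 transposed. Consequently, among all orderings of a fixed multiset of access probabilities, φ is minimized by the non-decreasing ordering q_1 ≤ q_2 ≤ … ≤ q_M. -/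
section

open Finset

/-- The expected number of transmissions over `n` trials, when trial `k` has transmission
probability `g (r k)` and failure probability `t (r k)`. -/
def expectedTransmissions (g t : ℝ → ℝ) (n : ℕ) (r : ℕ → ℝ) : ℝ :=
  ∑ k ∈ Icc 1 n, g (r k) * ∏ i ∈ Icc 1 (k - 1), t (r i)

lemma expectedTransmissions_succ (g t : ℝ → ℝ) (n : ℕ) (r : ℕ → ℝ) :
    expectedTransmissions g t (n + 1) r =
      expectedTransmissions g t n r + g (r (n + 1)) * ∏ i ∈ Icc 1 n, t (r i) := by
  simp [expectedTransmissions, sum_Icc_succ_top]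

lemma expectedTransmissions_congr (g t : ℝ → ℝ) {n : ℕ} {r s : ℕ → ℝ}
    (h : ∀ i ∈ Icc 1 n, r i = s i) :
    expectedTransmissions g t n r = expectedTransmissions g t n s := by
  refine sum_congr rfl fun k hk => ?_
  rw [h k hk]
  congr 1
  refine prod_congr rfl fun i hi => ?_
  rw [h i (by simp only [mem_Icc] at hk hi ⊢; omega)]

lemma prod_comp_perm_of_forall_notMem (t : ℝ → ℝ) (s : Finset ℕ) (r : ℕ → ℝ)
    (σ : Equiv.Perm ℕ) (hσ : ∀ i ∉ s, σ i = i) :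
    ∏ i ∈ s, t ((r ∘ σ) i) = ∏ i ∈ s, t (r i) :=
  Equiv.Perm.prod_comp σ s (fun i => t (r i)) fun i hi => by
    by_contra h
    exact hi (hσ i h)

lemma swap_succ_apply_of_notMem_Icc {k n : ℕ} (hk : 1 ≤ k) (hkn : k < n) :
    ∀ i ∉ Icc 1 n, Equiv.swap k (k + 1) i = i := fun i hi =>
  Equiv.swap_apply_of_ne_of_ne (by rintro rfl; simp at hi; omega)
    (by rintro rfl; simp at hi; omega)

/-- Swapping adjacent out-of-order entries does not increase the expected number of
transmissions. -/
lemma expectedTransmissions_comp_swap_le {g t : ℝ → ℝ}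
    (hgt : ∀ a b, b ≤ a → g b + t b * g a ≤ g a + t a * g b)
    {r : ℕ → ℝ} {k n : ℕ} (hk : 1 ≤ k) (hkn : k < n)
    (ht : ∀ i ∈ Icc 1 n, 0 ≤ t (r i)) (hr : r (k + 1) ≤ r k) :
    expectedTransmissions g t n (r ∘ Equiv.swap k (k + 1)) ≤ expectedTransmissions g t n r := by
  induction n, hkn using Nat.le_induction with
  | base =>
    obtain ⟨m, rfl⟩ : ∃ m, k = m + 1 := ⟨k - 1, by omega⟩
    have hfix : ∀ i ∈ Icc 1 m, (r ∘ Equiv.swap (m + 1) (m + 1 + 1)) i = r i := fun i hi => by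
      rw [mem_Icc] at hi
      rw [Function.comp_apply, Equiv.swap_apply_of_ne_of_ne (by omega) (by omega)]
    have hprod : 0 ≤ ∏ i ∈ Icc 1 m, t (r i) := prod_nonneg fun i hi =>
      ht i (Icc_subset_Icc_right (by omega) hi)
    have hcongr : ∏ i ∈ Icc 1 m, t ((r ∘ Equiv.swap (m + 1) (m + 1 + 1)) i) =
        ∏ i ∈ Icc 1 m, t (r i) := prod_congr rfl fun i hi => by rw [hfix i hi]
    simp only [Nat.succ_eq_add_one, expectedTransmissions_succ,
      prod_Icc_succ_top (show 1 ≤ m + 1 by omega),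
      expectedTransmissions_congr g t hfix, hcongr]
    simp only [Function.comp_apply, Equiv.swap_apply_left, Equiv.swap_apply_right]
    linear_combination mul_le_mul_of_nonneg_left (hgt _ _ hr) hprod
  | succ n hn ih =>
    rw [expectedTransmissions_succ, expectedTransmissions_succ,
      prod_comp_perm_of_forall_notMem t _ r _ (swap_succ_apply_of_notMem_Icc hk hn),
      Function.comp_apply, swap_succ_apply_of_notMem_Icc hk hn (n + 1) (by simp)]
    gcongr
    exact ih fun i hi => ht i (Icc_subset_Icc_right (by omega) hi)

/-- The non-decreasing ordering minimizes the expected number of transmissions. -/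
lemma expectedTransmissions_le_comp_perm {g t : ℝ → ℝ}
    (hgt : ∀ a b, b ≤ a → g b + t b * g a ≤ g a + t a * g b)
    {n : ℕ} {r : ℕ → ℝ} (ht : ∀ i ∈ Icc 1 n, 0 ≤ t (r i))
    (hr : ∀ i j, 1 ≤ i → i ≤ j → j ≤ n → r i ≤ r j)
    (σ : Equiv.Perm ℕ) (hσ : ∀ i ∉ Icc 1 n, σ i = i) :
    expectedTransmissions g t n r ≤ expectedTransmissions g t n (r ∘ σ) := by
  induction n generalizing σ with
  | zero => simp [expectedTransmissions]
  | succ n ih =>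
    have hmaps : ∀ τ : Equiv.Perm ℕ, (∀ i ∉ Icc 1 (n + 1), τ i = i) →
        ∀ i ∈ Icc 1 (n + 1), τ i ∈ Icc 1 (n + 1) := fun τ hτ i hi => by
      by_contra h
      exact h (by rwa [τ.injective (hτ _ h)])
    have hlast : ∀ j, j ≤ n + 1 → 1 ≤ j → ∀ τ : Equiv.Perm ℕ,
        (∀ i ∉ Icc 1 (n + 1), τ i = i) → τ j = n + 1 →
        expectedTransmissions g t (n + 1) r ≤ expectedTransmissions g t (n + 1) (r ∘ τ) := by
      intro j hj
      induction hj using Nat.decreasingInduction with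
      | self =>
        intro _ τ hτ hτn
        have hτ' : ∀ i ∉ Icc 1 n, τ i = i := fun i hi => by
          by_cases h : i = n + 1
          · rw [h, hτn]
          · exact hτ i (by simp only [mem_Icc] at hi ⊢; omega)
        rw [expectedTransmissions_succ, expectedTransmissions_succ,
          prod_comp_perm_of_forall_notMem t _ r τ hτ', Function.comp_apply, hτn]
        gcongr
        exact ih (fun i hi => ht i (Icc_subset_Icc_right (by omega) hi))
          (fun i j hi hij hj => hr i j hi hij (by omega)) τ hτ'
      | of_succ j hj ihj =>
        intro hj1 τ hτ hτj
        have hswap := swap_succ_apply_of_notMem_Icc hj1 hj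
        refine (ihj (by omega) (τ * Equiv.swap j (j + 1)) (fun i hi => ?_) ?_).trans
          (expectedTransmissions_comp_swap_le (r := r ∘ τ) hgt hj1 hj
            (fun i hi => ht _ (hmaps τ hτ i hi)) ?_)
        · rw [Equiv.Perm.mul_apply, hswap i hi, hτ i hi]
        · rw [Equiv.Perm.mul_apply, Equiv.swap_apply_right, hτj]
        · have hmem := mem_Icc.1 (hmaps τ hτ (j + 1) (by simp only [mem_Icc]; omega))
          rw [Function.comp_apply, Function.comp_apply, hτj]
          exact hr _ _ hmem.1 hmem.2 le_rfl
    have hmem : σ.symm (n + 1) ∈ Icc 1 (n + 1) := by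
      by_contra h
      have hfix := hσ _ h
      rw [Equiv.apply_symm_apply] at hfix
      rw [← hfix] at h
      simp at h
    rw [mem_Icc] at hmem
    exact hlast _ hmem.2 hmem.1 σ hσ (σ.apply_symm_apply _)

end

/-- Swapping two adjacent access probabilities that are out of (non-decreasing) order
leaves the cumulative outage probability `∏_{i=1}^M (β q_i + T)` unchanged and does not
increase the expected number of transmissions
`φ(q) = ∑_{k=1}^{M} (λ_p q_k + 1 - λ_p) ∏_{i=1}^{k-1} (β q_i + T)`.
Consequently, among all orderings of a fixed multiset of access probabilities, `φ` is
minimized by the non-decreasing ordering. -/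
theorem phi_minimized_by_nondecreasing_ordering
    (lp es1 es2 : ℝ) (hlp : lp ∈ Set.Icc (0:ℝ) 1)
    (hes1 : es1 ∈ Set.Icc (0:ℝ) 1) (hes2 : es2 ∈ Set.Icc (0:ℝ) 1) (h12 : es1 ≤ es2)
    (M : ℕ) (q : ℕ → ℝ) (hq : ∀ i ∈ Finset.Icc 1 M, q i ∈ Set.Icc (0:ℝ) 1) :
    let β : ℝ := lp * (es2 - 1)
    let T : ℝ := lp * (1 - es1) + es1
    let φf : (ℕ → ℝ) → ℝ := fun r =>
      ∑ k ∈ Finset.Icc 1 M,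
        (lp * r k + 1 - lp) * ∏ i ∈ Finset.Icc 1 (k - 1), (β * r i + T)
    (∀ k, 1 ≤ k → k < M → q (k + 1) ≤ q k →
      ((∏ i ∈ Finset.Icc 1 M, (β * (q ∘ Equiv.swap k (k + 1)) i + T)) =
          ∏ i ∈ Finset.Icc 1 M, (β * q i + T)) ∧
        φf (q ∘ Equiv.swap k (k + 1)) ≤ φf q) ∧
    ((∀ i j, 1 ≤ i → i ≤ j → j ≤ M → q i ≤ q j) →
      ∀ σ : Equiv.Perm ℕ, (∀ i ∉ Finset.Icc 1 M, σ i = i) →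
        φf q ≤ φf (q ∘ σ)) := by
  intro β T φf
  obtain ⟨hlp0, hlp1⟩ := hlp
  have hgt : ∀ a b : ℝ, b ≤ a →
      (lp * b + 1 - lp) + (β * b + T) * (lp * a + 1 - lp) ≤
        (lp * a + 1 - lp) + (β * a + T) * (lp * b + 1 - lp) := fun a b hab => by
    have hnonneg : 0 ≤ (a - b) * (lp * (1 - lp) * (es2 - es1)) :=
      mul_nonneg (sub_nonneg.2 hab)
        (mul_nonneg (mul_nonneg hlp0 (sub_nonneg.2 hlp1)) (sub_nonneg.2 h12))
    simp only [β, T]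
    linear_combination hnonneg
  have hθ : ∀ i ∈ Finset.Icc 1 M, 0 ≤ β * q i + T := fun i hi => by
    have hdiff : 0 ≤ lp * (es2 - es1) := mul_nonneg hlp0 (sub_nonneg.2 h12)
    have hrest : 0 ≤ lp * (1 - es2) * (1 - q i) :=
      mul_nonneg (mul_nonneg hlp0 (sub_nonneg.2 hes2.2)) (sub_nonneg.2 (hq i hi).2)
    simp only [β, T]
    linear_combination hdiff + hrest + hes1.1
  exact ⟨fun k hk hkM hqk =>
    ⟨prod_comp_perm_of_forall_notMem (fun x => β * x + T) _ q _
      (swap_succ_apply_of_notMem_Icc hk hkM),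
    expectedTransmissions_comp_swap_le (g := fun x => lp * x + 1 - lp)
      (t := fun x => β * x + T) hgt hk hkM hθ hqk⟩,
    fun hmono σ hσ => expectedTransmissions_le_comp_perm (g := fun x => lp * x + 1 - lp)
      (t := fun x => β * x + T) hgt hθ hmono σ hσ⟩
end

section
/- Let Q(x) = 1 − Φ(x) denote the tail function of the standard Gaussian distribution, let n ≥ 1 and R > 0 satisfy nR ≥ (1/2) log₂ n, and define v(σ) = (1 − (1+σ)^{-2})(log₂ e)². Then the map σ ↦ Q((n log₂(1+σ) − nR + (1/2) log₂ n)/√(n v(σ))) is monotone non-increasing on (0, ∞). In particular, for SINRs 0 < σ₂ ≤ σ₁, the finite-blocklength error probability at σ₁ is at most that at σ₂ (so the PU error probability with interference, evaluated at the reduced SINR p_p|h_p|²/(p_s|h_s|² + 1), is at least the PU error probability without interference, evaluated at p_p|h_p|²). -/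
theorem sub_div_le_sub_div_of_mul_sq_le {a₁ a₂ c d₁ d₂ : ℝ} (hd₁ : 0 < d₁) (hd : d₁ ≤ d₂)
    (ha₂ : 0 ≤ a₂) (hc : 0 ≤ c) (h : a₁ * d₂ ^ 2 ≤ a₂ * d₁ ^ 2) :
    (a₁ - c) / d₁ ≤ (a₂ - c) / d₂ := by
  have hd₂ : 0 < d₂ := hd₁.trans_le hd
  have hmul : a₁ * d₂ ≤ a₂ * d₁ := by
    refine le_of_mul_le_mul_right ?_ hd₂
    nlinarith [mul_le_mul_of_nonneg_left hd (mul_nonneg ha₂ hd₁.le)]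
  rw [div_le_div_iff₀ hd₁ hd₂]
  nlinarith [mul_le_mul_of_nonneg_left hd hc]

/-- The secant slope of the logarithm through `1`, evaluated at `u⁻²`, in cross-multiplied form. -/
theorem log_mul_one_sub_inv_sq_le {u w : ℝ} (hu : 1 < u) (huw : u ≤ w) :
    Real.log u * (1 - 1 / w ^ 2) ≤ Real.log w * (1 - 1 / u ^ 2) := by
  have hu₀ : 0 < u := one_pos.trans hu
  have hw : 1 < w := hu.trans_le huw
  have hw₀ : 0 < w := one_pos.trans hw
  have hu₁ : 1 / u ^ 2 < 1 := (div_lt_one (by positivity)).2 (by nlinarith)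
  have hw₁ : 1 / w ^ 2 < 1 := (div_lt_one (by positivity)).2 (by nlinarith)
  have hinv : 1 / w ^ 2 ≤ 1 / u ^ 2 := by gcongr
  have hsec := strictConcaveOn_log_Ioi.concaveOn.neg.secant_mono (a := 1) (x := 1 / w ^ 2)
    (y := 1 / u ^ 2) (Set.mem_Ioi.2 one_pos) (Set.mem_Ioi.2 (by positivity))
    (Set.mem_Ioi.2 (by positivity)) hw₁.ne hu₁.ne hinv
  simp only [Pi.neg_apply, Real.log_one, one_div, Real.log_inv, Real.log_pow] at hsec hu₁ hw₁ ⊢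
  rw [← neg_div_neg_eq, ← neg_div_neg_eq (_ - _) ((u ^ 2)⁻¹ - 1),
    div_le_div_iff₀ (by linarith) (by linarith)] at hsec
  push_cast at hsec
  linarith


/-- Monotonicity of the finite-blocklength error probability in the SINR: with
`Q(x) = 1 - Φ(x)` (standard Gaussian tail), `v(σ) = (1 - (1+σ)⁻²)(log₂ e)²`, `n ≥ 1`
and `n R ≥ (1/2) log₂ n`, the map
`σ ↦ Q((n log₂(1+σ) - n R + (1/2) log₂ n) / √(n v(σ)))` is non-increasing on `(0, ∞)`.
In particular the PU error probability at the interference-reduced SINR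
`p_p |h_p|² / (p_s |h_s|² + 1)` is at least the one at `p_p |h_p|²`. -/
theorem fb_error_probability_antitone_in_sinr
    (n : ℕ) (hn : 1 ≤ n) (R : ℝ) (hR : 0 < R)
    (hnR : (1 / 2) * Real.logb 2 n ≤ n * R) :
    let Q : ℝ → ℝ := fun x => 1 - ProbabilityTheory.cdf (ProbabilityTheory.gaussianReal 0 1) x
    let v : ℝ → ℝ := fun σ => (1 - 1 / (1 + σ) ^ 2) * (Real.logb 2 (Real.exp 1)) ^ 2
    let f : ℝ → ℝ := fun σ =>
      Q ((n * Real.logb 2 (1 + σ) - n * R + (1 / 2) * Real.logb 2 n) /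
          Real.sqrt (n * v σ))
    AntitoneOn f (Set.Ioi (0:ℝ)) ∧
    ∀ pp hp ps hs : ℝ, 0 < pp * hp ^ 2 → 0 ≤ ps * hs ^ 2 →
      f (pp * hp ^ 2) ≤ f (pp * hp ^ 2 / (ps * hs ^ 2 + 1)) := by
  intro Q v f
  have hf : AntitoneOn f (Set.Ioi (0 : ℝ)) := by
    intro x hx y hy hxy
    have hx₀ : 0 < x := hx
    have hy₀ : 0 < y := hy
    have hn₀ : (0 : ℝ) < n := by exact_mod_cast hn
    have hlog2 : 0 < Real.log 2 := Real.log_pos one_lt_two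
    have hK : 0 < (Real.logb 2 (Real.exp 1)) ^ 2 := by
      simp only [Real.logb, Real.log_exp]
      positivity
    have hvx : 0 < v x := mul_pos
      (sub_pos.2 ((div_lt_one (by positivity)).2 (by nlinarith))) hK
    have hvxy : v x ≤ v y := by
      refine mul_le_mul_of_nonneg_right ?_ hK.le
      gcongr
    have hvy : 0 < v y := hvx.trans_le hvxy
    refine sub_le_sub_left (ProbabilityTheory.monotone_cdf _ ?_) 1
    simp only [sub_add]
    refine sub_div_le_sub_div_of_mul_sq_le (by positivity) (by gcongr)
      (mul_nonneg hn₀.le (Real.logb_nonneg one_lt_two (by linarith))) (by linarith) ?_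
    rw [Real.sq_sqrt (by positivity), Real.sq_sqrt (by positivity)]
    have hlog := log_mul_one_sub_inv_sq_le (u := 1 + x) (w := 1 + y) (by linarith) (by linarith)
    have hscaled := mul_le_mul_of_nonneg_left hlog
      (by positivity : 0 ≤ n * n * (Real.logb 2 (Real.exp 1)) ^ 2 / Real.log 2)
    calc n * Real.logb 2 (1 + x) * (n * v y)
        = n * n * (Real.logb 2 (Real.exp 1)) ^ 2 / Real.log 2 *
            (Real.log (1 + x) * (1 - 1 / (1 + y) ^ 2)) := by
          simp only [v, ← Real.log_div_log]; ring
      _ ≤ _ := hscaled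
      _ = n * Real.logb 2 (1 + y) * (n * v x) := by
          simp only [v, ← Real.log_div_log]; ring
  refine ⟨hf, fun pp hp ps hs hP hS => hf ?_ hP ?_⟩
  · exact div_pos hP (by linarith)
  · exact div_le_self hP.le (by linarith)
end
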